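/- Let p ≥ 2 be an integer, let β > 0, B > 0, P > 0, σ² > 0, γ₁ ≥ 0, γ₂ ≥ 0 be real, and let d ≥ 3 be real. Define ρ = (1+γ₁)² + 12(1+γ₁)·γ₂/β² + 240·(γ₂/β²)² and ξ = (4/ln 2)·(p−1)·(P/σ²)·(1/(β²·B))·ρ. Then (1/B)·∫₀^B log₂(1 + 2(p−1)·2^{−2d}·(1+γ₁+γ₂·f)²·(P/σ²)·e^{−β√f}) df − 2·log₂(1 − 2^{−d+1.5}) ≤ ξ·2^{−2d} + 2^{−d+3.5}. -/

import Mathlib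

lemma aux_log (d : ℝ) (hd : 3 ≤ d) :
    - 2 * Real.logb 2 (1 - (2 : ℝ) ^ (-d + 1.5)) ≤ (2 : ℝ) ^ (-d + 3.5) := by
  have h4 : (2 : ℝ) ^ (-d + 3.5) = 4 * (2 : ℝ) ^ (-d + 1.5) := by
    rw [show (-d + 3.5 : ℝ) = (-d + 1.5) + (2 : ℕ) by norm_num; ring, Real.rpow_add_natCast (by norm_num)]
    ring
  rw [h4]
  have hx0 : 0 < (2 : ℝ) ^ (-d + 1.5) := by positivity
  have hx1 : (2 : ℝ) ^ (-d + 1.5) ≤ 1 / 2 := by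
    calc (2 : ℝ) ^ (-d + 1.5) ≤ (2 : ℝ) ^ (-1 : ℝ) :=
          Real.rpow_le_rpow_of_exponent_le (by norm_num) (by norm_num; linarith)
      _ = 1 / 2 := by rw [Real.rpow_neg_one]; norm_num
  generalize (2 : ℝ) ^ (-d + 1.5) = x at *
  have h := rpow_one_add_le_one_add_mul_self (s := -(1 / 2)) (p := 2 * x) (by norm_num)
    (by linarith) (by linarith)
  have h2 : (1 + -(1 / 2) : ℝ) ^ (2 * x) = (2 : ℝ) ^ (-(2 * x)) := by
    rw [Real.rpow_neg (by norm_num), ← Real.inv_rpow (by norm_num)]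
    norm_num
  rw [h2] at h
  have h3 : -(2 * x) ≤ Real.logb 2 (1 - x) := by
    rw [Real.le_logb_iff_rpow_le (by norm_num) (by linarith)]
    linarith
  linarith

lemma aux_int (a c β B : ℝ) (ha : 0 ≤ a) (hc : 0 ≤ c) (hβ : 0 < β) (hB : 0 < B) :
    (∫ f in (0 : ℝ)..B, (a + c * f) ^ 2 * Real.exp (-β * Real.sqrt f))
      ≤ 2 / β ^ 2 * (a ^ 2 + 12 * a * (c / β ^ 2) + 120 * (c / β ^ 2) ^ 2) := by
  obtain ⟨b, hb, hbβ⟩ : ∃ b : ℝ, 0 < b ∧ β * b = 1 := ⟨β⁻¹, by positivity, by field_simp⟩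
  let Q : ℝ → ℝ := fun u => 2 * a ^ 2 * (u * b + b ^ 2)
    + 4 * a * c * (u ^ 3 * b + 3 * u ^ 2 * b ^ 2 + 6 * u * b ^ 3 + 6 * b ^ 4)
    + 2 * c ^ 2 * (u ^ 5 * b + 5 * u ^ 4 * b ^ 2 + 20 * u ^ 3 * b ^ 3 + 60 * u ^ 2 * b ^ 4
      + 120 * u * b ^ 5 + 120 * b ^ 6)
  let Q' : ℝ → ℝ := fun u => 2 * a ^ 2 * b
    + 4 * a * c * (3 * u ^ 2 * b + 6 * u * b ^ 2 + 6 * b ^ 3)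
    + 2 * c ^ 2 * (5 * u ^ 4 * b + 20 * u ^ 3 * b ^ 2 + 60 * u ^ 2 * b ^ 3 + 120 * u * b ^ 4
      + 120 * b ^ 5)
  have hQ : ∀ u, HasDerivAt Q (Q' u) u := by
    intro u
    have h1 := hasDerivAt_id u
    have hp : ∀ n : ℕ, HasDerivAt (fun u : ℝ => u ^ n) (n * u ^ (n - 1)) u :=
      fun n => hasDerivAt_pow n u
    have := (((h1.mul_const b).add_const (b ^ 2)).const_mul (2 * a ^ 2)).add
      ((((((hp 3).mul_const b).add (((hp 2).const_mul 3).mul_const (b ^ 2))).add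
        ((h1.const_mul 6).mul_const (b ^ 3))).add_const (6 * b ^ 4)).const_mul (4 * a * c))
    have := this.add
      ((((((((hp 5).mul_const b).add (((hp 4).const_mul 5).mul_const (b ^ 2))).add
        (((hp 3).const_mul 20).mul_const (b ^ 3))).add
        (((hp 2).const_mul 60).mul_const (b ^ 4))).add
        ((h1.const_mul 120).mul_const (b ^ 5))).add_const (120 * b ^ 6)).const_mul (2 * c ^ 2))
    refine HasDerivAt.congr_deriv this ?_
    simp only [Q']
    norm_num
    ring
  let G : ℝ → ℝ := fun u => -(Q u * Real.exp (-β * u))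
  have hG : ∀ u, HasDerivAt G (2 * u * (a + c * u ^ 2) ^ 2 * Real.exp (-β * u)) u := by
    intro u
    have he : HasDerivAt (fun u : ℝ => Real.exp (-β * u)) (Real.exp (-β * u) * (-β * 1)) u :=
      ((hasDerivAt_id u).const_mul (-β)).exp
    refine HasDerivAt.congr_deriv ((hQ u).mul he).neg ?_
    have : β * Q u - Q' u = 2 * u * (a + c * u ^ 2) ^ 2 := by
      have e : β * Q u - Q' u - 2 * u * (a + c * u ^ 2) ^ 2 = (β * b - 1) *
        (2 * a ^ 2 * (u + b) + 4 * a * c * (u ^ 3 + 3 * u ^ 2 * b + 6 * u * b ^ 2 + 6 * b ^ 3)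
        + 2 * c ^ 2 * (u ^ 5 + 5 * u ^ 4 * b + 20 * u ^ 3 * b ^ 2 + 60 * u ^ 2 * b ^ 3
      + 120 * u * b ^ 4 + 120 * b ^ 5)) := by
        simp only [Q, Q']; ring
      rw [hbβ] at e
      linarith
    rw [← this]; ring
  have key := intervalIntegral.integral_eq_sub_of_hasDerivAt_of_le (f := fun f => G (Real.sqrt f))
    (f' := fun f => (a + c * f) ^ 2 * Real.exp (-β * Real.sqrt f)) hB.le
    (Continuous.continuousOn (by
      have : Continuous G := continuous_iff_continuousAt.2 fun u => (hG u).continuousAt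
      exact this.comp Real.continuous_sqrt))
    (by
      intro x hx
      have hs : 0 < Real.sqrt x := Real.sqrt_pos.2 hx.1
      have := (hG (Real.sqrt x)).comp x (Real.hasDerivAt_sqrt hx.1.ne')
      refine HasDerivAt.congr_deriv this ?_
      rw [Real.sq_sqrt hx.1.le]
      field_simp)
    (Continuous.intervalIntegrable (by fun_prop) _ _)
  rw [key]
  have hGB : G (Real.sqrt B) ≤ 0 := by
    have : 0 ≤ Q (Real.sqrt B) := by simp only [Q]; positivity
    have := mul_nonneg this (Real.exp_pos (-β * Real.sqrt B)).le
    simp only [G]; linarith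
  have hG0 : G (Real.sqrt 0) = -(2 / β ^ 2 * (a ^ 2 + 12 * a * (c / β ^ 2) + 120 * (c / β ^ 2) ^ 2)) := by
    have : b = 1 / β := by field_simp; linarith
    simp only [G, Q, this, Real.sqrt_zero, mul_zero, Real.exp_zero]
    field_simp
    ring
  linarith

/-- under the Werner model and sub-linear row dominance, the
average per-Hz rate-loss bound satisfies
`(1/B)∫₀^B log₂(1 + 2(p−1)2^{−2d}(1+γ₁+γ₂f)²(P/σ²)e^{−β√f}) df
 − 2log₂(1 − 2^{−d+1.5}) ≤ ξ·2^{−2d} + 2^{−d+3.5}`. -/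
theorem stmt_15 {p : ℕ} (hp : 2 ≤ p) (β B P σ2 γ1 γ2 d : ℝ)
    (hβ : 0 < β) (hB : 0 < B) (hP : 0 < P) (hσ : 0 < σ2)
    (hγ1 : 0 ≤ γ1) (hγ2 : 0 ≤ γ2) (hd : 3 ≤ d)
    (ρ ξ : ℝ)
    (hρ : ρ = (1 + γ1) ^ 2 + 12 * (1 + γ1) * γ2 / β ^ 2 + 240 * (γ2 / β ^ 2) ^ 2)
    (hξ : ξ = (4 / Real.log 2) * ((p : ℝ) - 1) * (P / σ2) * (1 / (β ^ 2 * B)) * ρ) :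
    (1 / B) * (∫ f in (0 : ℝ)..B,
        Real.logb 2 (1 + 2 * ((p : ℝ) - 1) * (2 : ℝ) ^ (-(2 * d))
          * (1 + γ1 + γ2 * f) ^ 2 * (P / σ2) * Real.exp (-β * Real.sqrt f)))
      - 2 * Real.logb 2 (1 - (2 : ℝ) ^ (-d + 1.5))
      ≤ ξ * (2 : ℝ) ^ (-(2 * d)) + (2 : ℝ) ^ (-d + 3.5) := by
  have h1 := aux_log d hd
  have h2 := aux_int (1 + γ1) γ2 β B (by linarith) hγ2 hβ hB
  have hp1 : (0 : ℝ) < (p : ℝ) - 1 := by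
    have : (2 : ℝ) ≤ p := by exact_mod_cast hp
    linarith
  have hl : 0 < Real.log 2 := Real.log_pos (by norm_num)
  have ht : 0 < (2 : ℝ) ^ (-(2 * d)) := by positivity
  generalize (2 : ℝ) ^ (-(2 * d)) = t at *
  generalize (p : ℝ) - 1 = q at *
  have hpos : ∀ f : ℝ, 0 ≤ 2 * q * t
          * (1 + γ1 + γ2 * f) ^ 2 * (P / σ2) * Real.exp (-β * Real.sqrt f) := by
    intro f; positivity
  have h3 : (∫ f in (0 : ℝ)..B, Real.logb 2 (1 + 2 * q * t
          * (1 + γ1 + γ2 * f) ^ 2 * (P / σ2) * Real.exp (-β * Real.sqrt f))) ≤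
      ∫ f in (0 : ℝ)..B, (2 * q * t * (P / σ2) / Real.log 2) *
        ((1 + γ1 + γ2 * f) ^ 2 * Real.exp (-β * Real.sqrt f)) := by
    apply intervalIntegral.integral_mono_on hB.le
    · apply Continuous.intervalIntegrable
      unfold Real.logb
      apply Continuous.div_const
      apply Continuous.log (by fun_prop)
      intro f
      have := hpos f
      linarith
    · exact Continuous.intervalIntegrable (by fun_prop) _ _
    · intro f _
      have h := Real.log_le_sub_one_of_pos (x := 1 + 2 * q * t
          * (1 + γ1 + γ2 * f) ^ 2 * (P / σ2) * Real.exp (-β * Real.sqrt f))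
          (by linarith [hpos f])
      unfold Real.logb
      calc _ ≤ _ := div_le_div_of_nonneg_right h hl.le
        _ = _ := by ring
  rw [intervalIntegral.integral_const_mul] at h3
  have h4 : 2 / β ^ 2 * ((1 + γ1) ^ 2 + 12 * (1 + γ1) * (γ2 / β ^ 2) + 120 * (γ2 / β ^ 2) ^ 2)
      ≤ 2 / β ^ 2 * ρ := by
    apply mul_le_mul_of_nonneg_left _ (by positivity)
    rw [hρ, mul_div_assoc]
    nlinarith [sq_nonneg (γ2 / β ^ 2)]
  have h5 := h3.trans (mul_le_mul_of_nonneg_left (h2.trans h4)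
    (show 0 ≤ 2 * q * t * (P / σ2) / Real.log 2 by positivity))
  have h6 := mul_le_mul_of_nonneg_left h5 (show 0 ≤ 1 / B by positivity)
  have h7 : 1 / B * (2 * q * t * (P / σ2) / Real.log 2 * (2 / β ^ 2 * ρ)) = ξ * t := by
    rw [hξ]; field_simp; ring
  linarith
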